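/- For x ∈ ℝ^{2n} and t ∈ ℝ, the 2n×2n matrix B + 2K, where B = |x|² I_{2n} + a t J and K = x xᵀ is the rank-one matrix with entries x_i x_j, satisfies det(B + 2K) = (|x|⁴ + a²t²)^{n−1} (3|x|⁴ + a²t²). -/

import Mathlib

noncomputable section

/-- The standard `2n × 2n` block matrix `[[0, Iₙ],[−Iₙ, 0]]`. -/
def Jmat (n : ℕ) : Matrix (Fin (2*n)) (Fin (2*n)) ℝ :=
  Matrix.of fun i j =>
    if (i : ℕ) < n ∧ (j : ℕ) = (i : ℕ) + n then 1
    else if n ≤ (i : ℕ) ∧ (i : ℕ) = (j : ℕ) + n then -1 else 0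

open scoped Kronecker in
theorem Jmat_eq_reindex_kronecker (n : ℕ) :
    Jmat n = Matrix.reindex finProdFinEquiv finProdFinEquiv
      (!![(0 : ℝ), 1; -1, 0] ⊗ₖ (1 : Matrix (Fin n) (Fin n) ℝ)) := by
  ext i j
  obtain ⟨⟨i₁, i₂⟩, rfl⟩ := finProdFinEquiv.surjective i
  obtain ⟨⟨j₁, j₂⟩, rfl⟩ := finProdFinEquiv.surjective j
  have hi := i₂.isLt
  have hj := j₂.isLt
  fin_cases i₁ <;> fin_cases j₁ <;>
    simp [Jmat, Matrix.one_apply, Fin.ext_iff] <;> grind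

open scoped Matrix in
theorem Jmat_transpose (n : ℕ) : (Jmat n)ᵀ = -Jmat n := by
  ext i j
  simp only [Jmat, Matrix.transpose_apply, Matrix.neg_apply, Matrix.of_apply]
  split_ifs <;> first | omega | simp

open scoped Kronecker in
theorem Jmat_mul_self (n : ℕ) : Jmat n * Jmat n = -1 := by
  have h : !![(0 : ℝ), 1; -1, 0] * !![(0 : ℝ), 1; -1, 0] = (-1 : ℝ) • 1 := by
    ext i j
    fin_cases i <;> fin_cases j <;> simp
  rw [Jmat_eq_reindex_kronecker, Matrix.reindex_apply, Matrix.submatrix_mul_equiv,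
    ← Matrix.mul_kronecker_mul, h, mul_one, Matrix.smul_kronecker, Matrix.one_kronecker_one,
    neg_one_smul, Matrix.submatrix_neg, Pi.neg_apply, Pi.neg_apply, Matrix.submatrix_one_equiv]

open scoped Kronecker in
theorem det_smul_one_add_smul_Jmat (n : ℕ) (s b : ℝ) :
    (s • (1 : Matrix (Fin (2 * n)) (Fin (2 * n)) ℝ) + b • Jmat n).det = (s ^ 2 + b ^ 2) ^ n := by
  have h : s • (1 : Matrix (Fin (2 * n)) (Fin (2 * n)) ℝ) + b • Jmat n =
      Matrix.reindex finProdFinEquiv finProdFinEquiv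
        ((s • 1 + b • !![(0 : ℝ), 1; -1, 0]) ⊗ₖ (1 : Matrix (Fin n) (Fin n) ℝ)) := by
    rw [Jmat_eq_reindex_kronecker, Matrix.add_kronecker, Matrix.smul_kronecker,
      Matrix.smul_kronecker, Matrix.one_kronecker_one, Matrix.reindex_apply, Matrix.reindex_apply,
      ← Matrix.submatrix_one_equiv (finProdFinEquiv (m := 2) (n := n)).symm]
    rfl
  rw [h, Matrix.det_reindex_self, Matrix.det_kronecker, Matrix.det_one, one_pow, mul_one,
    Fintype.card_fin, Matrix.det_fin_two]
  congr 1
  simp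
  ring

open Matrix in
theorem dotProduct_Jmat_mulVec_self (n : ℕ) (x : Fin (2 * n) → ℝ) :
    x ⬝ᵥ Jmat n *ᵥ x = 0 := by
  have h : x ⬝ᵥ Jmat n *ᵥ x = -(x ⬝ᵥ Jmat n *ᵥ x) := by
    conv_lhs => rw [dotProduct_mulVec, ← mulVec_transpose, Jmat_transpose, neg_mulVec,
      neg_dotProduct, dotProduct_comm]
  linarith

theorem smul_one_add_smul_Jmat_inv (n : ℕ) {s b : ℝ} (h : s ^ 2 + b ^ 2 ≠ 0) :
    (s • (1 : Matrix (Fin (2 * n)) (Fin (2 * n)) ℝ) + b • Jmat n)⁻¹ =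
      (s ^ 2 + b ^ 2)⁻¹ • (s • 1 - b • Jmat n) := by
  apply Matrix.inv_eq_right_inv
  have hmul : (s • (1 : Matrix (Fin (2 * n)) (Fin (2 * n)) ℝ) + b • Jmat n) *
      (s • 1 - b • Jmat n) = (s ^ 2 + b ^ 2) • 1 := by
    simp only [add_mul, mul_sub, smul_mul_smul_comm, Jmat_mul_self, mul_one, one_mul]
    module
  rw [mul_smul_comm, hmul, inv_smul_smul₀ h]

/-- `det(B + 2K) = (|x|⁴ + a²t²)^{n−1} (3|x|⁴ + a²t²)` where
`B = |x|² I_{2n} + a t J` and `K = x xᵀ`. -/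
theorem det_B_add_two_K (n : ℕ) (hn : 1 ≤ n) (a : ℝ) (x : Fin (2*n) → ℝ) (t : ℝ) :
    ((∑ i, x i ^ 2) • (1 : Matrix (Fin (2*n)) (Fin (2*n)) ℝ)
      + (a * t) • Jmat n
      + (2 : ℝ) • Matrix.of (fun i j => x i * x j)).det
    = ((∑ i, x i ^ 2) ^ 2 + a ^ 2 * t ^ 2) ^ (n - 1)
        * (3 * (∑ i, x i ^ 2) ^ 2 + a ^ 2 * t ^ 2) := by
  set s := ∑ i, x i ^ 2 with hs
  have hxx : x ⬝ᵥ x = s := by simp [hs, dotProduct, sq]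
  by_cases hd : s ^ 2 + (a * t) ^ 2 = 0
  · have hs0 : s = 0 := by nlinarith [sq_nonneg s, sq_nonneg (a * t)]
    have hb0 : a * t = 0 := by nlinarith [sq_nonneg s, sq_nonneg (a * t)]
    have hx : x = 0 := dotProduct_self_eq_zero.mp (hxx.trans hs0)
    have : Nonempty (Fin (2 * n)) := ⟨⟨0, by omega⟩⟩
    have hK : Matrix.of (fun i j => x i * x j) = 0 := by
      ext i j
      simp [hx]
    rw [hK, hs0, hb0, ← mul_pow, hb0]
    simp [Matrix.det_zero]
  · have hK : (2 : ℝ) • Matrix.of (fun i j => x i * x j) =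
        Matrix.replicateCol Unit ((2 : ℝ) • x) * Matrix.replicateRow Unit x := by
      ext i j
      simp [Matrix.mul_apply, mul_assoc]
    have hdet := det_smul_one_add_smul_Jmat n s (a * t)
    have hunit : IsUnit (s • (1 : Matrix (Fin (2 * n)) (Fin (2 * n)) ℝ) + (a * t) • Jmat n).det :=
      hdet ▸ (pow_ne_zero n hd).isUnit
    have hquad : x ⬝ᵥ (s • 1 - (a * t) • Jmat n).mulVec x = s ^ 2 := by
      rw [Matrix.sub_mulVec, Matrix.smul_mulVec, Matrix.smul_mulVec, Matrix.one_mulVec,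
        dotProduct_sub, dotProduct_smul, dotProduct_smul, dotProduct_Jmat_mulVec_self, hxx]
      simp [sq]
    rw [hK, Matrix.det_add_replicateCol_mul_replicateRow hunit, hdet,
      smul_one_add_smul_Jmat_inv n hd, Matrix.det_unique, Matrix.add_apply, Matrix.one_apply_eq,
      Matrix.mul_assoc, ← Matrix.replicateCol_mulVec, Matrix.replicateRow_mul_replicateCol_apply,
      Matrix.mulVec_smul, Matrix.smul_mulVec, dotProduct_smul, dotProduct_smul, hquad,
      smul_eq_mul, smul_eq_mul, ← mul_pow]
    obtain ⟨m, rfl⟩ := Nat.exists_eq_add_of_le' hn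
    have hd3 : 3 * s ^ 2 + (a * t) ^ 2 = (s ^ 2 + (a * t) ^ 2) + 2 * s ^ 2 := by ring
    rw [hd3, Nat.add_sub_cancel, pow_succ]
    generalize s ^ 2 + (a * t) ^ 2 = d at hd
    field_simp

end
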